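/- arXiv:math/0511160 — 2 statements merged into one kernel-verified Lean document; each statement's English description precedes it below -/
import Mathlib

section
/- Let V be a finite-dimensional vector space over a field of characteristic zero, N : V → V a nilpotent endomorphism, and k ∈ ℤ. Then there exists an increasing filtration W_• of V by subspaces (W_{j} ⊆ W_{j+1}, W_j = 0 for j sufficiently small, W_j = V for j sufficiently large) such that N(W_j) ⊆ W_{j−2} for all j and, for every j ≥ 0, the map induced by N^j from Gr^W_{k+j} = W_{k+j}/W_{k+j−1} to Gr^W_{k−j} = W_{k−j}/W_{k−j−1} is an isomorphism. -/
/-- A weight filtration of a nilpotent endomorphism `N` centered at `k`: an increasing,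
exhaustive and separated filtration `W` with `N(W_j) ⊆ W_{j−2}` such that for every `j ≥ 0`
the map induced by `N^j` from `Gr^W_{k+j} = W_{k+j}/W_{k+j−1}` to `Gr^W_{k−j} = W_{k−j}/W_{k−j−1}`
is an isomorphism.  The last two clauses express, at the level of submodules, injectivity and
surjectivity of this induced map. -/
structure IsWeightFiltration {F V : Type*} [Field F] [AddCommGroup V] [Module F V]
    (N : V →ₗ[F] V) (k : ℤ) (W : ℤ → Submodule F V) : Prop where
  mono : Monotone W
  eventually_bot : ∃ a : ℤ, ∀ j ≤ a, W j = ⊥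
  eventually_top : ∃ b : ℤ, ∀ j, b ≤ j → W j = ⊤
  map_le : ∀ j : ℤ, (W j).map N ≤ W (j - 2)
  induced_inj : ∀ j : ℕ, ∀ x ∈ W (k + j), (N ^ j) x ∈ W (k - j - 1) → x ∈ W (k + j - 1)
  induced_surj : ∀ j : ℕ, W (k - j) ≤ W (k - j - 1) ⊔ (W (k + j)).map (N ^ j)

theorem relative_weight_aux {F V : Type*} [Field F] [AddCommGroup V] [Module F V]
    (N : V →ₗ[F] V) (n : ℕ) : ∀ A B : Submodule F V, B ≤ A → (∀ x ∈ A, N x ∈ A) →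
    (∀ x ∈ B, N x ∈ B) → (∀ x ∈ A, (N ^ (n + 1)) x ∈ B) →
    ∃ W : ℤ → Submodule F V, Monotone W ∧ (∀ j : ℤ, j ≤ -n - 1 → W j = B) ∧
      (∀ j : ℤ, n ≤ j → W j = A) ∧ (∀ j : ℤ, ∀ x ∈ W j, N x ∈ W (j - 2)) ∧
      (∀ j : ℕ, ∀ x ∈ W j, (N ^ j) x ∈ W (-j - 1) → x ∈ W (j - 1)) ∧
      (∀ j : ℕ, ∀ x ∈ W (-j), ∃ y ∈ W (-j - 1), ∃ z ∈ W j, y + (N ^ j) z = x) := by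
  induction n with
  | zero =>
    intro A B hBA hA hB hN
    have hN1 : ∀ x ∈ A, N x ∈ B := by simpa using hN
    refine ⟨fun j => if 0 ≤ j then A else B, ?_, ?_, ?_, ?_, ?_, ?_⟩
    · intro i j hij
      dsimp only
      split_ifs
      · exact le_rfl
      · omega
      · exact hBA
      · exact le_rfl
    · intro j hj
      exact if_neg (by push_cast at hj; omega)
    · intro j hj
      exact if_pos (by push_cast at hj; omega)
    · intro j x hx
      dsimp only at hx ⊢
      have hxA : x ∈ A := by
        split_ifs at hx
        · exact hx
        · exact hBA hx
      split_ifs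
      · exact hBA (hN1 x hxA)
      · exact hN1 x hxA
    · intro j x hx hx2
      dsimp only at hx hx2 ⊢
      rw [if_pos (by omega)] at hx
      rw [if_neg (by omega)] at hx2
      rcases Nat.eq_zero_or_pos j with rfl | hj
      · rw [if_neg (by simp)]
        simpa using hx2
      · rw [if_pos (by omega)]
        exact hx
    · intro j x hx
      dsimp only at hx ⊢
      rw [if_neg (by omega), if_pos (by omega)]
      rcases Nat.eq_zero_or_pos j with rfl | hj
      · exact ⟨0, B.zero_mem, x, by simpa using hx, by simp⟩
      · rw [if_neg (by omega)] at hx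
        exact ⟨x, hx, 0, A.zero_mem, by simp⟩
  | succ n ih =>
    intro A B hBA hA hB hN
    have hpA : ∀ i : ℕ, ∀ x ∈ A, (N ^ i) x ∈ A := by
      intro i
      induction i with
      | zero => intro x hx; simpa using hx
      | succ i ihi => intro x hx; rw [pow_succ']; exact hA _ (ihi x hx)
    have hpB : ∀ i : ℕ, ∀ x ∈ B, (N ^ i) x ∈ B := by
      intro i
      induction i with
      | zero => intro x hx; simpa using hx
      | succ i ihi => intro x hx; rw [pow_succ']; exact hB _ (ihi x hx)
    have hs : ∀ (i : ℕ) x, (N ^ (i + 1)) x = N ((N ^ i) x) := by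
      intro i x; rw [pow_succ']; rfl
    have hs2 : ∀ (i : ℕ) x, (N ^ (i + 1)) x = (N ^ i) (N x) := by
      intro i x; rw [pow_succ]; rfl
    obtain ⟨A', hA'⟩ : ∃ A' : Submodule F V, ∀ x, x ∈ A' ↔ x ∈ A ∧ (N ^ (n + 1)) x ∈ B :=
      ⟨A ⊓ B.comap (N ^ (n + 1)), fun x => Iff.rfl⟩
    obtain ⟨B', hB'⟩ : ∃ B' : Submodule F V,
        ∀ x, x ∈ B' ↔ ∃ y ∈ B, ∃ z ∈ A, y + (N ^ (n + 1)) z = x :=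
      ⟨B ⊔ A.map (N ^ (n + 1)), fun x => by simp [Submodule.mem_sup]⟩
    have hBB' : B ≤ B' := fun x hx => (hB' x).2 ⟨x, hx, 0, A.zero_mem, by simp⟩
    have hA'A : A' ≤ A := fun x hx => ((hA' x).1 hx).1
    have hNB' : ∀ x ∈ B', N x ∈ B := by
      intro x hx
      obtain ⟨y, hy, z, hz, rfl⟩ := (hB' x).1 hx
      rw [map_add, ← hs]
      exact B.add_mem (hB y hy) (hN z hz)
    have hNA : ∀ x ∈ A, N x ∈ A' := fun x hx => (hA' _).2 ⟨hA x hx, by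
      rw [← hs2]; exact hN x hx⟩
    have hB'A' : B' ≤ A' := by
      intro x hx
      refine (hA' x).2 ⟨?_, ?_⟩
      · obtain ⟨y, hy, z, hz, rfl⟩ := (hB' x).1 hx
        exact A.add_mem (hBA hy) (hpA _ z hz)
      · rw [hs2]; exact hpB _ _ (hNB' x hx)
    obtain ⟨W, hm, hbot, htop, hmap, hinj, hsurj⟩ := ih A' B' hB'A'
      (fun x hx => hNA x (hA'A hx)) (fun x hx => hBB' (hNB' x hx))
      (fun x hx => hBB' ((hA' x).1 hx).2)
    have hWA : ∀ j, W j ≤ A' := fun j => (hm (le_max_left j n)).trans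
      (htop _ (le_max_right _ _)).le
    have hWB : ∀ j, B' ≤ W j := fun j => (hbot _ (min_le_right j (-n - 1))).ge.trans
      (hm (min_le_left _ _))
    obtain ⟨U, hU⟩ : ∃ U : ℤ → Submodule F V, U = fun j : ℤ =>
      if (n : ℤ) + 1 ≤ j then A else if j ≤ -n - 2 then B else W j := ⟨_, rfl⟩
    have U1 : ∀ j : ℤ, (n : ℤ) + 1 ≤ j → U j = A := fun j hj => by
      rw [hU]; exact if_pos hj
    have U2 : ∀ j : ℤ, j ≤ -n - 2 → U j = B := fun j hj => by
      rw [hU]; dsimp only; rw [if_neg (by omega), if_pos hj]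
    have U3 : ∀ j : ℤ, j ≤ n → -n - 1 ≤ j → U j = W j := fun j hj hj2 => by
      rw [hU]; dsimp only; rw [if_neg (by omega), if_neg (by omega)]
    have hUA : ∀ j, U j ≤ A := by
      intro j
      rw [hU]; dsimp only
      split_ifs
      · exact le_rfl
      · exact hBA
      · exact (hWA j).trans hA'A
    have hUB : ∀ j, B ≤ U j := by
      intro j
      rw [hU]; dsimp only
      split_ifs
      · exact hBA
      · exact le_rfl
      · exact hBB'.trans (hWB j)
    refine ⟨U, ?_, ?_, ?_, ?_, ?_, ?_⟩
    · intro i j hij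
      by_cases h1 : (n : ℤ) + 1 ≤ j
      · rw [U1 j h1]; exact hUA i
      by_cases h2 : i ≤ -n - 2
      · rw [U2 i h2]; exact hUB j
      rw [U3 i (by omega) (by omega), U3 j (by omega) (by omega)]
      exact hm hij
    · intro j hj
      exact U2 j (by push_cast at hj; omega)
    · intro j hj
      exact U1 j (by push_cast at hj; omega)
    · intro j x hx
      have hxA := hUA j hx
      by_cases h1 : (n : ℤ) + 3 ≤ j
      · rw [U1 _ (by omega)]; exact hA x hxA
      by_cases h2 : (n : ℤ) + 2 = j
      · rw [U3 _ (by omega) (by omega), htop _ (by omega)]; exact hNA x hxA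
      by_cases h3 : (n : ℤ) + 1 = j
      · rw [U3 _ (by omega) (by omega)]
        have := hinj n (N x) (by rw [htop _ le_rfl]; exact hNA x hxA) (by
          rw [hbot _ le_rfl, ← hs2]
          exact (hB' _).2 ⟨0, B.zero_mem, x, hxA, by simp⟩)
        rwa [show j - 2 = (n : ℤ) - 1 by omega]
      by_cases h4 : j ≤ -n - 2
      · rw [U2 _ h4] at hx
        exact hUB _ (hB x hx)
      rw [U3 _ (by omega) (by omega)] at hx
      by_cases h5 : j = -n - 1
      · rw [hbot _ (by omega)] at hx
        exact hUB _ (hNB' x hx)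
      by_cases h6 : j = -n
      · subst h6
        obtain ⟨y, hy, z, hz, rfl⟩ := hsurj n x hx
        rw [hbot _ le_rfl] at hy
        rw [map_add, ← hs]
        exact hUB _ (B.add_mem (hNB' y hy) ((hA' z).1 (hWA _ hz)).2)
      rw [U3 _ (by omega) (by omega)]
      exact hmap j x hx
    · intro j x hx hx2
      have hxA := hUA j hx
      by_cases h1 : n + 2 ≤ j
      · rw [U1 _ (by omega)]; exact hxA
      by_cases h2 : j = n + 1
      · subst h2
        rw [U2 _ (by omega)] at hx2
        rw [U3 _ (by omega) (by omega), htop _ (by omega)]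
        exact (hA' x).2 ⟨hxA, hx2⟩
      rw [U3 _ (by omega) (by omega)] at hx hx2 ⊢
      exact hinj j x hx hx2
    · intro j x hx
      by_cases h1 : n + 2 ≤ j
      · rw [U2 _ (by omega)] at hx
        exact ⟨x, hUB _ hx, 0, Submodule.zero_mem _, by simp⟩
      by_cases h2 : j = n + 1
      · subst h2
        rw [U3 _ (by omega) (by omega), hbot _ (by omega)] at hx
        rw [U2 _ (by omega), U1 _ (by omega)]
        exact (hB' x).1 hx
      rw [U3 _ (by omega) (by omega)] at hx ⊢
      rw [U3 _ (by omega) (by omega)]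
      exact hsurj j x hx

/-- Existence of the weight filtration: for every nilpotent endomorphism `N` of a
finite-dimensional vector space over a field of characteristic zero and every `k ∈ ℤ`
there is a weight filtration of `N` centered at `k`. -/
theorem stmt6 {F V : Type*} [Field F] [CharZero F] [AddCommGroup V] [Module F V]
    [FiniteDimensional F V] (N : V →ₗ[F] V) (hN : IsNilpotent N) (k : ℤ) :
    ∃ W : ℤ → Submodule F V, IsWeightFiltration N k W := by
  obtain ⟨n, hn⟩ := hN
  obtain ⟨W, hm, hbot, htop, hmap, hinj, hsurj⟩ := relative_weight_aux N n ⊤ ⊥ bot_le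
    (fun _ _ => trivial) (fun x hx => by simp_all) (fun x _ => by simp [pow_succ, hn])
  refine ⟨fun j => W (j - k), ?_, ?_, ?_, ?_, ?_, ?_⟩
  · intro i j hij
    exact hm (by omega)
  · exact ⟨k - n - 1, fun j hj => hbot _ (by omega)⟩
  · exact ⟨k + n, fun j hj => htop _ (by omega)⟩
  · rintro j _ ⟨x, hx, rfl⟩
    have := hmap _ x hx
    rwa [show j - 2 - k = j - k - 2 by ring]
  · intro j x hx hx2
    rw [show k + (j : ℤ) - k = j by ring] at hx
    rw [show k - (j : ℤ) - 1 - k = -j - 1 by ring] at hx2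
    rw [show k + (j : ℤ) - 1 - k = j - 1 by ring]
    exact hinj j x hx hx2
  · intro j x hx
    rw [show k - (j : ℤ) - k = -j by ring] at hx
    rw [show k - (j : ℤ) - 1 - k = -j - 1 by ring, show k + (j : ℤ) - k = j by ring]
    obtain ⟨y, hy, z, hz, rfl⟩ := hsurj j x hx
    exact Submodule.add_mem_sup hy (Submodule.mem_map_of_mem hz)
end

section
/- Let V be a finite-dimensional real vector space with a real Hodge structure pure of weight k, and let γ : V → V be an ℝ-linear automorphism of finite order whose complexification γ_ℂ satisfies γ_ℂ(V^{p,q}) ⊆ V^{p,q} for all p,q. For a ∈ ℚ ∩ [0,1) set H_a := ker(γ_ℂ − e^{2πia}·id) ⊆ V_ℂ. Then V_ℂ = ⊕_{p∈ℤ, a∈ℚ∩[0,1)} (H_a ∩ V^{p,k−p}), and the decomposition defined by H̃^{p,k−p} := H_0 ∩ V^{p,k−p} and H̃^{p+a, k+1−a−p} := H_a ∩ V^{p,k−p} for 0 < a < 1 satisfies the conjugation symmetry σ(H̃^{α,β}) = H̃^{β,α} for all α,β ∈ ℚ. Hence (V, H̃^{•,•}) is a direct sum of fractional Hodge structures pure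 of weights k and k+1. -/
open TensorProduct

noncomputable section

/-- The conjugation `σ` on the complexification `ℂ ⊗[ℝ] V`, induced by complex conjugation
on the scalar factor.  It is `ℝ`-linear (and `ℂ`-antilinear). -/
def conjMap (V : Type*) [AddCommGroup V] [Module ℝ V] :
    ℂ ⊗[ℝ] V →ₗ[ℝ] ℂ ⊗[ℝ] V :=
  TensorProduct.map Complex.conjAe.toLinearMap LinearMap.id

lemma conjMap_smul (V : Type*) [AddCommGroup V] [Module ℝ V] (c : ℂ) (x : ℂ ⊗[ℝ] V) :
    conjMap V (c • x) = (starRingEnd ℂ) c • conjMap V x := by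
  induction x using TensorProduct.induction_on with
  | zero => simp
  | tmul a v =>
      simp [conjMap, TensorProduct.smul_tmul', smul_eq_mul, map_mul]
  | add x y hx hy => simp [smul_add, map_add, hx, hy]

/-- A real Hodge structure on a finite-dimensional real vector space `V`: a direct sum
decomposition `V_ℂ = ⊕_{p,q ∈ ℤ} V^{p,q}` of the complexification `V_ℂ = ℂ ⊗[ℝ] V` into
complex subspaces such that `V^{q,p} = σ(V^{p,q})`. -/
structure RealHodgeStructure (V : Type*) [AddCommGroup V] [Module ℝ V] where
  piece : ℤ × ℤ → Submodule ℂ (ℂ ⊗[ℝ] V)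
  isInternal : DirectSum.IsInternal piece
  conj_symm : ∀ p q : ℤ,
    (Submodule.restrictScalars ℝ (piece (p, q))).map (conjMap V) =
      Submodule.restrictScalars ℝ (piece (q, p))

end

noncomputable section

/-- A family of pieces is pure of weight `k` if the `(p,q)`-piece vanishes when `p + q ≠ k`. -/
def IsPureOfWeight {M : Type*} [AddCommGroup M] [Module ℂ M]
    (piece : ℤ × ℤ → Submodule ℂ M) (k : ℤ) : Prop :=
  ∀ pq : ℤ × ℤ, pq.1 + pq.2 ≠ k → piece pq = ⊥

variable {V : Type*} [AddCommGroup V] [Module ℝ V]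

/-- `H_a = ker(γ_ℂ − e^{2πia}·id) ⊆ V_ℂ`. -/
def eigenPart (γ : V ≃ₗ[ℝ] V) (a : ℚ) : Submodule ℂ (ℂ ⊗[ℝ] V) :=
  LinearMap.ker (γ.toLinearMap.baseChange ℂ -
    Complex.exp (2 * (Real.pi : ℂ) * Complex.I * (a : ℂ)) •
      (LinearMap.id : ℂ ⊗[ℝ] V →ₗ[ℂ] ℂ ⊗[ℝ] V))

/-- The pieces `H̃^{α,β}` of the associated fractional Hodge structure:
`H̃^{p,k−p} = H_0 ∩ V^{p,k−p}` and, for `0 < a < 1`,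
`H̃^{p+a,k+1−a−p} = H_a ∩ V^{p,k−p}`. -/
def tildePiece (Hv : RealHodgeStructure V) (γ : V ≃ₗ[ℝ] V) (k : ℤ) (αβ : ℚ × ℚ) :
    Submodule ℂ (ℂ ⊗[ℝ] V) :=
  ⨆ pa : ℤ × ℚ, ⨆ _ : (0 ≤ pa.2 ∧ pa.2 < 1) ∧
      ((pa.2 = 0 ∧ αβ = ((pa.1 : ℚ), (k : ℚ) - (pa.1 : ℚ))) ∨
        (0 < pa.2 ∧ αβ = ((pa.1 : ℚ) + pa.2, (k : ℚ) + 1 - pa.2 - (pa.1 : ℚ)))),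
    eigenPart γ pa.2 ⊓ Hv.piece (pa.1, k - pa.1)

lemma aux_indep {M : Type*} [AddCommGroup M] [Module ℂ M] {I J : Type*}
    (E : J → Submodule ℂ M) (P : I → Submodule ℂ M) (hE : iSupIndep E) (hP : iSupIndep P) :
    iSupIndep (fun i : I × J => E i.2 ⊓ P i.1) := by
  rintro ⟨p, a⟩
  rw [Submodule.disjoint_def]
  rintro x ⟨hxE, hxP⟩ hx
  have hle : (⨆ (j : I × J) (_ : j ≠ (p, a)), E j.2 ⊓ P j.1) ≤
      (⨆ (p' : I) (_ : p' ≠ p), P p') ⊔ ((⨆ (a' : J) (_ : a' ≠ a), E a') ⊓ P p) := by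
    refine iSup₂_le ?_
    rintro ⟨p', a'⟩ h
    by_cases hp : p' = p
    · subst hp
      have ha : a' ≠ a := by
        rintro rfl
        exact h rfl
      exact le_sup_of_le_right
        (inf_le_inf_right _ (le_iSup₂ (f := fun (a' : J) (_ : a' ≠ a) => E a') a' ha))
    · exact le_sup_of_le_left (inf_le_right.trans
        (le_iSup₂ (f := fun (p' : I) (_ : p' ≠ p) => P p') p' hp))
  obtain ⟨y, hy, z, hz, hyz⟩ := Submodule.mem_sup.1 (hle hx)
  have hyP : y ∈ P p := by
    have : y = x - z := by rw [← hyz]; abel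
    rw [this]
    exact (P p).sub_mem hxP hz.2
  have hy0 : y = 0 := (Submodule.disjoint_def.1 (hP p)) y hyP hy
  have hxz : x = z := by rw [← hyz, hy0, zero_add]
  refine (Submodule.disjoint_def.1 (hE a)) x hxE ?_
  rw [hxz]
  exact hz.1

lemma aux_indep_fiber {M : Type*} [AddCommGroup M] [Module ℂ M] {I J : Type*}
    (g : I → Submodule ℂ M) (hg : iSupIndep g) (φ : I → J) (hφ : Function.Injective φ) :
    iSupIndep (fun j : J => ⨆ (i : I) (_ : φ i = j), g i) := by
  intro j
  by_cases hj : ∃ i, φ i = j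
  · obtain ⟨i, rfl⟩ := hj
    refine (hg i).mono ?_ ?_
    · refine iSup₂_le fun i' h => ?_
      rw [hφ h]
    · refine iSup₂_le fun j' hj' => iSup₂_le fun i' h => ?_
      have : i' ≠ i := by
        rintro rfl
        exact hj' h.symm
      exact le_iSup₂ (f := fun (i' : I) (_ : i' ≠ i) => g i') i' this
  · have : (⨆ (i : I) (_ : φ i = j), g i) = ⊥ := by
      refine le_bot_iff.1 (iSup₂_le fun i h => absurd ⟨i, h⟩ hj)
    show Disjoint (⨆ (i : I) (_ : φ i = j), g i) _
    rw [this]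
    exact disjoint_bot_left

lemma eigenPart_eq (γ : V ≃ₗ[ℝ] V) (a : ℚ) :
    eigenPart γ a = Module.End.eigenspace (γ.toLinearMap.baseChange ℂ)
      (Complex.exp (2 * (Real.pi : ℂ) * Complex.I * (a : ℂ))) := by
  ext x
  rw [Module.End.mem_eigenspace_iff]
  simp [eigenPart, sub_eq_zero]

lemma mem_eigenPart (γ : V ≃ₗ[ℝ] V) (a : ℚ) (x : ℂ ⊗[ℝ] V) :
    x ∈ eigenPart γ a ↔ γ.toLinearMap.baseChange ℂ x =
      Complex.exp (2 * (Real.pi : ℂ) * Complex.I * (a : ℂ)) • x := by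
  rw [eigenPart_eq, Module.End.mem_eigenspace_iff]

lemma exp_inj {a b : ℚ} (ha : 0 ≤ a ∧ a < 1) (hb : 0 ≤ b ∧ b < 1)
    (h : Complex.exp (2 * (Real.pi : ℂ) * Complex.I * (a : ℂ)) =
      Complex.exp (2 * (Real.pi : ℂ) * Complex.I * (b : ℂ))) : a = b := by
  obtain ⟨n, hn⟩ := Complex.exp_eq_exp_iff_exists_int.1 h
  have h1 : (a : ℂ) = b + n := by
    have := Complex.two_pi_I_ne_zero
    apply mul_left_cancel₀ this
    rw [hn]; ring
  have h2 : a = b + n := by exact_mod_cast h1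
  have h3 : n < 1 := by
    have : (n : ℚ) < 1 := by linarith [ha.2, hb.1]
    exact_mod_cast this
  have h4 : -1 < n := by
    have : (-1 : ℚ) < n := by linarith [ha.1, hb.2]
    exact_mod_cast this
  have h5 : n = 0 := by omega
  rw [h2, h5]; simp

lemma aux_span [FiniteDimensional ℝ V] (γ : V ≃ₗ[ℝ] V) (hfin : ∃ n : ℕ, 0 < n ∧ γ ^ n = 1)
    (P : Submodule ℂ (ℂ ⊗[ℝ] V)) (hP : P.map (γ.toLinearMap.baseChange ℂ) ≤ P) :
    P ≤ ⨆ a : {a : ℚ // 0 ≤ a ∧ a < 1}, eigenPart γ a.1 ⊓ P := by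
  obtain ⟨n, hn, hγn⟩ := hfin
  set f : Module.End ℂ (ℂ ⊗[ℝ] V) := γ.toLinearMap.baseChange ℂ with hf
  have hpow : f ^ n = 1 := by
    have h1 : (γ.toLinearMap : Module.End ℝ V) ^ n = 1 := by
      ext v
      have := congrArg (fun e : V ≃ₗ[ℝ] V => e v) hγn
      rw [Module.End.pow_apply]
      have h2 : ∀ m : ℕ, (γ.toLinearMap : V → V)^[m] v = (γ ^ m) v := by
        intro m
        induction m with
        | zero => simp
        | succ m ih => rw [Function.iterate_succ_apply', ih, pow_succ']; rfl
      rw [h2]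
      exact this
    rw [hf, ← LinearMap.baseChange_pow, h1, LinearMap.baseChange_one]
  have hss : f.IsSemisimple := by
    have hsep : (Polynomial.X ^ n - 1 : Polynomial ℂ).Separable :=
      Polynomial.X_pow_sub_one_separable_iff.2 (by exact_mod_cast hn.ne')
    refine Module.End.isSemisimple_of_squarefree_aeval_eq_zero hsep.squarefree ?_
    simp [hpow]
  have htop := hss.iSup_eigenspace_eq_top
  have hinv : ∀ x ∈ P, f x ∈ P := fun x hx => hP (Submodule.mem_map_of_mem hx)
  have hdec : P = ⨆ μ, P ⊓ f.eigenspace μ := by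
    have := Submodule.inf_iSup_genEigenspace (p := P) (f := f) hinv 1
    have h2 : (⨆ μ, f.genEigenspace μ 1) = ⊤ := htop
    rw [h2, inf_top_eq] at this
    exact this
  conv_lhs => rw [hdec]
  refine iSup_le fun μ => ?_
  intro x hx
  by_cases hx0 : x = 0
  · rw [hx0]; exact Submodule.zero_mem _
  have hfx : f x = μ • x := Module.End.mem_eigenspace_iff.1 hx.2
  have hμ : μ ^ n = 1 := by
    have h1 : ∀ m : ℕ, (f ^ m) x = μ ^ m • x := by
      intro m
      induction m with
      | zero => simp
      | succ m ih => rw [pow_succ', Module.End.mul_apply, ih, map_smul, hfx, smul_smul, pow_succ]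
    have h2 := h1 n
    rw [hpow, Module.End.one_apply] at h2
    have h3 : (μ ^ n - 1) • x = 0 := by rw [sub_smul, ← h2, one_smul, sub_self]
    rcases smul_eq_zero.1 h3 with h | h
    · exact sub_eq_zero.1 h
    · exact absurd h hx0
  haveI : NeZero n := ⟨hn.ne'⟩
  obtain ⟨i, hi, hexp⟩ := (Complex.mem_rootsOfUnity n (Units.ofPowEqOne μ n hμ hn.ne')).1
    (by rw [mem_rootsOfUnity]; ext; simpa using hμ)
  have hn' : (0 : ℚ) < n := by exact_mod_cast hn
  have ha : (0 : ℚ) ≤ (i : ℚ) / n ∧ (i : ℚ) / n < 1 := by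
    refine ⟨by positivity, ?_⟩
    rw [div_lt_one hn']
    exact_mod_cast hi
  refine (le_iSup (fun a : {a : ℚ // 0 ≤ a ∧ a < 1} => eigenPart γ a.1 ⊓ P)
    ⟨(i : ℚ) / n, ha⟩) ⟨?_, hx.1⟩
  rw [SetLike.mem_coe, mem_eigenPart]
  have : Complex.exp (2 * (Real.pi : ℂ) * Complex.I * (((i : ℚ) / n : ℚ) : ℂ)) = μ := by
    push_cast
    simpa using hexp
  rw [this]
  exact hfx

lemma aux_internal [FiniteDimensional ℝ V]
    (Hv : RealHodgeStructure V) (k : ℤ) (hk : IsPureOfWeight Hv.piece k)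
    (γ : V ≃ₗ[ℝ] V) (hfin : ∃ n : ℕ, 0 < n ∧ γ ^ n = 1)
    (hγ : ∀ pq : ℤ × ℤ, (Hv.piece pq).map (γ.toLinearMap.baseChange ℂ) ≤ Hv.piece pq) :
    iSupIndep (fun i : ℤ × {a : ℚ // 0 ≤ a ∧ a < 1} =>
        eigenPart γ i.2.1 ⊓ Hv.piece (i.1, k - i.1)) ∧
    (⨆ i : ℤ × {a : ℚ // 0 ≤ a ∧ a < 1},
        eigenPart γ i.2.1 ⊓ Hv.piece (i.1, k - i.1)) = ⊤ := by
  constructor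
  · refine aux_indep (fun a : {a : ℚ // 0 ≤ a ∧ a < 1} => eigenPart γ a.1)
      (fun p : ℤ => Hv.piece (p, k - p)) ?_ ?_
    · simp_rw [eigenPart_eq]
      refine (Module.End.eigenspaces_iSupIndep (γ.toLinearMap.baseChange ℂ)).comp
        (f := fun a : {a : ℚ // 0 ≤ a ∧ a < 1} =>
          Complex.exp (2 * (Real.pi : ℂ) * Complex.I * (a.1 : ℂ))) ?_
      intro a b h
      exact Subtype.ext (exp_inj a.2 b.2 h)
    · refine Hv.isInternal.submodule_iSupIndep.comp (f := fun p : ℤ => (p, k - p)) ?_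
      intro a b h
      exact (Prod.mk.inj h).1
  · rw [eq_top_iff, ← Hv.isInternal.submodule_iSup_eq_top]
    refine iSup_le ?_
    rintro ⟨p, q⟩
    by_cases h : p + q = k
    · obtain rfl : q = k - p := by omega
      refine (aux_span γ hfin _ (hγ _)).trans (iSup_le fun a => ?_)
      exact le_iSup (fun i : ℤ × {a : ℚ // 0 ≤ a ∧ a < 1} =>
        eigenPart γ i.2.1 ⊓ Hv.piece (i.1, k - i.1)) (p, a)
    · rw [hk (p, q) h]
      exact bot_le

/-- The bidegree attached to the index `(p, a)`. -/
def bideg (k : ℤ) (i : ℤ × {a : ℚ // 0 ≤ a ∧ a < 1}) : ℚ × ℚ :=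
  if i.2.1 = 0 then ((i.1 : ℚ), (k : ℚ) - (i.1 : ℚ))
  else ((i.1 : ℚ) + i.2.1, (k : ℚ) + 1 - i.2.1 - (i.1 : ℚ))

lemma bideg_fst (k : ℤ) (i : ℤ × {a : ℚ // 0 ≤ a ∧ a < 1}) :
    (bideg k i).1 = (i.1 : ℚ) + i.2.1 := by
  unfold bideg
  split_ifs with h
  · simp [h]
  · rfl

lemma bideg_inj (k : ℤ) : Function.Injective (bideg k) := by
  rintro ⟨p, a, ha⟩ ⟨q, b, hb⟩ h
  have h1 := congrArg Prod.fst h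
  rw [bideg_fst, bideg_fst] at h1
  simp only at h1
  have h3 : p - q < 1 := by
    have : (p : ℚ) - q < 1 := by linarith [ha.1, hb.2]
    exact_mod_cast this
  have h4 : -1 < p - q := by
    have : (-1 : ℚ) < p - q := by linarith [ha.2, hb.1]
    exact_mod_cast this
  obtain rfl : p = q := by omega
  have : a = b := by linarith
  subst this
  rfl

lemma tildePiece_eq (Hv : RealHodgeStructure V) (γ : V ≃ₗ[ℝ] V) (k : ℤ) (αβ : ℚ × ℚ) :
    tildePiece Hv γ k αβ = ⨆ (i : ℤ × {a : ℚ // 0 ≤ a ∧ a < 1}) (_ : bideg k i = αβ),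
      eigenPart γ i.2.1 ⊓ Hv.piece (i.1, k - i.1) := by
  unfold tildePiece
  apply le_antisymm
  · refine iSup₂_le ?_
    rintro ⟨p, a⟩ ⟨ha, h⟩
    refine le_iSup₂ (f := fun (i : ℤ × {a : ℚ // 0 ≤ a ∧ a < 1}) (_ : bideg k i = αβ) =>
      eigenPart γ i.2.1 ⊓ Hv.piece (i.1, k - i.1)) (p, ⟨a, ha⟩) ?_
    unfold bideg
    rcases h with ⟨h0, h⟩ | ⟨h0, h⟩
    · rw [if_pos h0, h]
    · rw [if_neg h0.ne', h]
  · refine iSup₂_le ?_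
    rintro ⟨p, a, ha⟩ h
    refine le_iSup₂_of_le (p, a) ⟨ha, ?_⟩ le_rfl
    unfold bideg at h
    by_cases h0 : a = 0
    · left
      rw [if_pos h0] at h
      exact ⟨h0, h.symm⟩
    · right
      rw [if_neg h0] at h
      exact ⟨lt_of_le_of_ne ha.1 (Ne.symm h0), h.symm⟩

lemma conjMap_conjMap (x : ℂ ⊗[ℝ] V) : conjMap V (conjMap V x) = x := by
  induction x using TensorProduct.induction_on with
  | zero => simp
  | tmul a v => simp [conjMap]
  | add x y hx hy => simp [map_add, hx, hy]

lemma conjMap_baseChange (γ : V ≃ₗ[ℝ] V) (x : ℂ ⊗[ℝ] V) :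
    γ.toLinearMap.baseChange ℂ (conjMap V x) = conjMap V (γ.toLinearMap.baseChange ℂ x) := by
  induction x using TensorProduct.induction_on with
  | zero => simp
  | tmul a v => simp [conjMap]
  | add x y hx hy => simp only [map_add, hx, hy]

lemma conj_eigenPart (γ : V ≃ₗ[ℝ] V) {a b : ℚ} (m : ℤ) (hab : b = m - a) {x : ℂ ⊗[ℝ] V}
    (hx : x ∈ eigenPart γ a) : conjMap V x ∈ eigenPart γ b := by
  rw [mem_eigenPart] at hx ⊢
  rw [conjMap_baseChange, hx, conjMap_smul, ← Complex.exp_conj]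
  congr 1
  rw [Complex.exp_eq_exp_iff_exists_int]
  refine ⟨-m, ?_⟩
  rw [hab]
  simp only [map_mul, Complex.conj_ofReal, Complex.conj_I, map_ofNat, map_ratCast]
  push_cast
  ring

lemma conj_piece (Hv : RealHodgeStructure V) (p q : ℤ) {x : ℂ ⊗[ℝ] V}
    (hx : x ∈ Hv.piece (p, q)) : conjMap V x ∈ Hv.piece (q, p) := by
  have h : conjMap V x ∈ Submodule.restrictScalars ℝ (Hv.piece (q, p)) := by
    rw [← Hv.conj_symm]
    exact Submodule.mem_map_of_mem hx
  exact h

/-- The preimage of a complex subspace under conjugation. -/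
def conjComap (W : Submodule ℂ (ℂ ⊗[ℝ] V)) : Submodule ℂ (ℂ ⊗[ℝ] V) where
  carrier := {x | conjMap V x ∈ W}
  add_mem' := by
    intro x y hx hy
    simp only [Set.mem_ofPred_eq, map_add] at *
    exact W.add_mem hx hy
  zero_mem' := by simp
  smul_mem' := by
    intro c x hx
    simp only [Set.mem_ofPred_eq, conjMap_smul] at *
    exact W.smul_mem _ hx

lemma conj_tildePiece (Hv : RealHodgeStructure V) (γ : V ≃ₗ[ℝ] V) (k : ℤ) (α β : ℚ)
    {x : ℂ ⊗[ℝ] V} (hx : x ∈ tildePiece Hv γ k (α, β)) :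
    conjMap V x ∈ tildePiece Hv γ k (β, α) := by
  have hle : tildePiece Hv γ k (α, β) ≤ conjComap (tildePiece Hv γ k (β, α)) := by
    refine iSup₂_le ?_
    rintro ⟨p, a⟩ ⟨ha, h⟩ x ⟨hx1, hx2⟩
    show conjMap V x ∈ tildePiece Hv γ k (β, α)
    have hpc : conjMap V x ∈ Hv.piece (k - p, k - (k - p)) := by
      rw [sub_sub_cancel]
      exact conj_piece Hv _ _ hx2
    rcases h with ⟨h0, h⟩ | ⟨h0, h⟩
    · simp only [Prod.mk.injEq] at h h0
      refine (le_iSup₂_of_le (k - p, (0 : ℚ)) ⟨⟨le_rfl, one_pos⟩, Or.inl ⟨rfl, ?_⟩⟩ le_rfl :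
        eigenPart γ 0 ⊓ Hv.piece (k - p, k - (k - p)) ≤ _) ⟨?_, hpc⟩
      · exact conj_eigenPart γ (a := a) 0 (by simp [h0]) hx1
      · rw [h.1, h.2]
        push_cast
        rw [sub_sub_cancel]
    · simp only [Prod.mk.injEq] at h h0 ha
      refine (le_iSup₂_of_le (k - p, 1 - a)
        ⟨⟨by linarith [ha.2], by linarith⟩, Or.inr ⟨by linarith [ha.2], ?_⟩⟩ le_rfl :
        eigenPart γ (1 - a) ⊓ Hv.piece (k - p, k - (k - p)) ≤ _) ⟨?_, hpc⟩
      · exact conj_eigenPart γ (a := a) 1 (by simp) hx1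
      · rw [h.1, h.2]
        push_cast
        ext <;> simp only <;> ring
  exact hle hx

/-- Let `V` carry a real Hodge structure pure of weight `k` and let `γ` be a finite-order
automorphism of `V` whose complexification preserves the pieces.  Then
`V_ℂ = ⊕_{p∈ℤ, a∈ℚ∩[0,1)} (H_a ∩ V^{p,k−p})`, the pieces `H̃^{α,β}` satisfy the conjugation
symmetry `σ(H̃^{α,β}) = H̃^{β,α}`, and they form a decomposition of `V_ℂ` which is a direct
sum of fractional Hodge structures pure of weights `k` and `k+1`. -/
theorem stmt14 [FiniteDimensional ℝ V]
    (Hv : RealHodgeStructure V) (k : ℤ) (hk : IsPureOfWeight Hv.piece k)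
    (γ : V ≃ₗ[ℝ] V) (hfin : ∃ n : ℕ, 0 < n ∧ γ ^ n = 1)
    (hγ : ∀ pq : ℤ × ℤ, (Hv.piece pq).map (γ.toLinearMap.baseChange ℂ) ≤ Hv.piece pq) :
    DirectSum.IsInternal
      (fun i : ℤ × {a : ℚ // 0 ≤ a ∧ a < 1} =>
        eigenPart γ i.2.1 ⊓ Hv.piece (i.1, k - i.1)) ∧
    (∀ α β : ℚ,
      (Submodule.restrictScalars ℝ (tildePiece Hv γ k (α, β))).map (conjMap V) =
        Submodule.restrictScalars ℝ (tildePiece Hv γ k (β, α))) ∧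
    DirectSum.IsInternal (tildePiece Hv γ k) ∧
    (∀ αβ : ℚ × ℚ, αβ.1 + αβ.2 ≠ (k : ℚ) → αβ.1 + αβ.2 ≠ (k : ℚ) + 1 →
      tildePiece Hv γ k αβ = ⊥) := by
  obtain ⟨hind, htop⟩ := aux_internal Hv k hk γ hfin hγ
  refine ⟨DirectSum.isInternal_submodule_of_iSupIndep_of_iSup_eq_top hind htop, ?_, ?_, ?_⟩
  · intro α β
    apply le_antisymm
    · rintro _ ⟨x, hx, rfl⟩
      exact conj_tildePiece Hv γ k α β hx
    · intro x hx
      exact ⟨conjMap V x, conj_tildePiece Hv γ k β α hx, conjMap_conjMap x⟩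
  · have heq : tildePiece Hv γ k = fun αβ => ⨆ (i : ℤ × {a : ℚ // 0 ≤ a ∧ a < 1})
        (_ : bideg k i = αβ), eigenPart γ i.2.1 ⊓ Hv.piece (i.1, k - i.1) :=
      funext (tildePiece_eq Hv γ k)
    refine DirectSum.isInternal_submodule_of_iSupIndep_of_iSup_eq_top ?_ ?_
    · rw [heq]
      exact aux_indep_fiber _ hind _ (bideg_inj k)
    · rw [eq_top_iff, ← htop, heq]
      refine iSup_le fun i => le_iSup_of_le (bideg k i) ?_
      exact le_iSup₂ (f := fun (j : ℤ × {a : ℚ // 0 ≤ a ∧ a < 1}) (_ : bideg k j = bideg k i) =>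
        eigenPart γ j.2.1 ⊓ Hv.piece (j.1, k - j.1)) i rfl
  · intro αβ h1 h2
    refine le_bot_iff.1 (iSup₂_le ?_)
    rintro ⟨p, a⟩ ⟨_, ⟨_, h⟩ | ⟨_, h⟩⟩
    · exact absurd (by rw [h]; simp) h1
    · exact absurd (by rw [h]; simp only; ring) h2

end
end
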